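/- arXiv:2007.02398 — 2 statements merged into one kernel-verified Lean document; each statement's English description precedes it below -/
import Mathlib

section
/- Let n ≥ 4 and k ≥ 1 be integers with 2k + 1 ≤ n, let a < b be real numbers, and let c₁, …, c_n be real numbers. Then there exist real numbers b > z₂ > z₃ > ⋯ > z_k > a with z_s ≠ 0 for all s = 2,…,k, and real numbers σ₁, …, σ_{k+1} > 0 such that c_j = b^{j−1}σ₁ + Σ_{s=2}^{k} z_s^{j−1} σ_s + a^{j−1}σ_{k+1} for every j = 1, …, n, if and only if the following three conditions hold: (B₁) det {c^{a,b}_{i+j−1+d}}_{i,j=1}^{k} = 0 for every integer d with 0 ≤ d ≤ n − 1 − 2k; (B₂) the (k−1)×(k−1) Hankel matrices {c^{a,b}_{i+j−1}}_{i,j=1}^{k−1} and {c^{a,b}_{i+j+1}}_{i,j=1}^{k−1} are positive definite; (B₃) the (k+1)×(k+1) Hankel matrix {c_{i+j−1}}_{i,j=1}^{k+1} is positive definite. -/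
open Finset

section MomentFunctional

open Polynomial

/-- The linear functional on real polynomials sending `X ^ i` to `m i`. -/
noncomputable def momentFunctional (m : ℕ → ℝ) : ℝ[X] →ₗ[ℝ] ℝ :=
  Polynomial.lsum fun i => LinearMap.toSpanSingleton ℝ ℝ (m i)

/-- The Hankel matrix of size `N` of a sequence. -/
def hankel (m : ℕ → ℝ) (N : ℕ) : Matrix (Fin N) (Fin N) ℝ :=
  Matrix.of fun i j => m (i.1 + j.1)

/-- The polynomial with a given coefficient vector. -/
noncomputable def polyOfVec {N : ℕ} (x : Fin N → ℝ) : ℝ[X] := ∑ i, C (x i) * X ^ i.1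

theorem momentFunctional_eq_sum (m : ℕ → ℝ) {p : ℝ[X]} {N : ℕ} (hN : p.natDegree < N) :
    momentFunctional m p = ∑ i ∈ range N, p.coeff i * m i := by
  rw [momentFunctional, Polynomial.lsum_apply]
  rw [Polynomial.sum_over_range' p (by simp) N hN]
  simp

@[simp]
theorem momentFunctional_C_mul_X_pow (m : ℕ → ℝ) (r : ℝ) (i : ℕ) :
    momentFunctional m (C r * X ^ i) = r * m i := by
  simp [momentFunctional, Polynomial.lsum_apply, C_mul_X_pow_eq_monomial]

@[simp]
theorem momentFunctional_X_pow (m : ℕ → ℝ) (i : ℕ) : momentFunctional m (X ^ i) = m i := by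
  simpa using momentFunctional_C_mul_X_pow m 1 i

theorem linearMap_ext_X_pow {f g : ℝ[X] →ₗ[ℝ] ℝ} (h : ∀ i, f (X ^ i) = g (X ^ i)) : f = g := by
  refine Polynomial.lhom_ext' fun i => LinearMap.ext_ring ?_
  simpa [← X_pow_eq_monomial] using h i

theorem momentFunctional_shift (m : ℕ → ℝ) (d : ℕ) (p : ℝ[X]) :
    momentFunctional (fun i => m (i + d)) p = momentFunctional m (X ^ d * p) := by
  have : momentFunctional (fun i => m (i + d)) =
      momentFunctional m ∘ₗ LinearMap.mulLeft ℝ (X ^ d) :=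
    linearMap_ext_X_pow fun i => by simp [← pow_add, add_comm]
  simp [this]

theorem momentFunctional_localized (c : ℕ → ℝ) (a b : ℝ) (p : ℝ[X]) :
    momentFunctional (fun i => -c (i + 2) + (a + b) * c (i + 1) - a * b * c i) p =
      momentFunctional c ((X - C a) * (C b - X) * p) := by
  have : momentFunctional (fun i => -c (i + 2) + (a + b) * c (i + 1) - a * b * c i) =
      momentFunctional c ∘ₗ LinearMap.mulLeft ℝ ((X - C a) * (C b - X)) := by
    refine linearMap_ext_X_pow fun i => ?_
    have : (X - C a) * (C b - X) * X ^ i =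
        C (-1) * X ^ (i + 2) + C (a + b) * X ^ (i + 1) - C (a * b) * X ^ i := by
      simp only [C_add, C_mul, C_neg, C_1]; ring
    rw [LinearMap.comp_apply, LinearMap.mulLeft_apply, this, map_sub, map_add,
      momentFunctional_C_mul_X_pow, momentFunctional_C_mul_X_pow, momentFunctional_C_mul_X_pow,
      momentFunctional_X_pow]
    ring
  rw [this, LinearMap.comp_apply, LinearMap.mulLeft_apply]

theorem momentFunctional_eq_coeff_mul {e : ℕ → ℝ} {p : ℝ[X]} {i : ℕ}
    (hp : p.natDegree ≤ i) (he : ∀ j < i, e j = 0) :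
    momentFunctional e p = p.coeff i * e i := by
  rw [momentFunctional_eq_sum e (Nat.lt_succ_of_le hp), sum_range_succ, sum_eq_zero, zero_add]
  intro j hj
  rw [he j (mem_range.1 hj), mul_zero]

theorem momentFunctional_eq_sub_add (m : ℕ → ℝ) (Z : Finset ℝ) (w : ℝ → ℝ) (p : ℝ[X]) :
    momentFunctional m p = momentFunctional (fun i => m i - ∑ z ∈ Z, w z * z ^ i) p +
      ∑ z ∈ Z, w z * p.eval z := by
  have : momentFunctional m = momentFunctional (fun i => m i - ∑ z ∈ Z, w z * z ^ i) +
      ∑ z ∈ Z, w z • Polynomial.leval z :=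
    linearMap_ext_X_pow fun i => by simp
  conv_lhs => rw [this]
  simp

theorem momentFunctional_eq_sum_eval {m : ℕ → ℝ} {Z : Finset ℝ} {w : ℝ → ℝ} {p : ℝ[X]} {N : ℕ}
    (hm : ∀ i < N, m i = ∑ z ∈ Z, w z * z ^ i) (hp : p.natDegree < N) :
    momentFunctional m p = ∑ z ∈ Z, w z * p.eval z := by
  rw [momentFunctional_eq_sub_add m Z w, momentFunctional_eq_coeff_mul le_rfl,
    sub_eq_zero.2 (hm _ hp)]
  · simp
  · exact fun j hj => sub_eq_zero.2 (hm _ (hj.trans hp))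

theorem polyOfVec_coeff {N : ℕ} (x : Fin N → ℝ) (i : Fin N) : (polyOfVec x).coeff i = x i := by
  simp [polyOfVec, coeff_X_pow, Fin.val_inj]

theorem polyOfVec_eq_zero {N : ℕ} {x : Fin N → ℝ} : polyOfVec x = 0 ↔ x = 0 := by
  refine ⟨fun h => funext fun i => ?_, fun h => by simp [h, polyOfVec]⟩
  rw [← polyOfVec_coeff x i, h]; rfl

theorem natDegree_polyOfVec_lt {N : ℕ} {x : Fin N → ℝ} (hx : x ≠ 0) :
    (polyOfVec x).natDegree < N :=
  (natDegree_lt_iff_degree_lt (mt polyOfVec_eq_zero.1 hx)).2 (degree_sum_fin_lt x)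

theorem exists_polyOfVec_eq {N : ℕ} {p : ℝ[X]} (hp : p.natDegree < N) :
    ∃ x : Fin N → ℝ, polyOfVec x = p := by
  refine ⟨fun i => p.coeff i, ?_⟩
  rw [polyOfVec, Fin.sum_univ_eq_sum_range (fun i => C (p.coeff i) * X ^ i) N]
  exact (as_sum_range_C_mul_X_pow' p hp).symm

theorem dotProduct_hankel_mulVec (m : ℕ → ℝ) {N : ℕ} (x y : Fin N → ℝ) :
    x ⬝ᵥ (hankel m N).mulVec y = momentFunctional m (polyOfVec x * polyOfVec y) := by
  have h : polyOfVec x * polyOfVec y =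
      ∑ i : Fin N, ∑ j : Fin N, C (x i * y j) * X ^ (i.1 + j.1) := by
    rw [polyOfVec, polyOfVec, sum_mul_sum]
    refine sum_congr rfl fun i _ => sum_congr rfl fun j _ => ?_
    rw [C_mul, pow_add]
    ring
  simp only [h, map_sum, momentFunctional_C_mul_X_pow, dotProduct, Matrix.mulVec, hankel,
    Matrix.of_apply, mul_sum]
  exact sum_congr rfl fun i _ => sum_congr rfl fun j _ => by ring

theorem posDef_hankel_iff {m : ℕ → ℝ} {N : ℕ} : (hankel m N).PosDef ↔
    ∀ p : ℝ[X], p ≠ 0 → p.natDegree < N → 0 < momentFunctional m (p * p) := by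
  rw [Matrix.posDef_iff_dotProduct_mulVec]
  constructor
  · rintro ⟨-, h⟩ p hp0 hp
    obtain ⟨x, rfl⟩ := exists_polyOfVec_eq hp
    have := h (mt polyOfVec_eq_zero.2 hp0)
    rwa [star_trivial, dotProduct_hankel_mulVec] at this
  · intro h
    refine ⟨Matrix.IsHermitian.ext fun i j => by simp [hankel, add_comm], fun x hx => ?_⟩
    rw [star_trivial, dotProduct_hankel_mulVec]
    exact h _ (mt polyOfVec_eq_zero.1 hx) (natDegree_polyOfVec_lt hx)

theorem det_hankel_eq_zero_iff {m : ℕ → ℝ} {N : ℕ} : (hankel m N).det = 0 ↔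
    ∃ q : ℝ[X], q ≠ 0 ∧ q.natDegree < N ∧
      ∀ p : ℝ[X], p.natDegree < N → momentFunctional m (p * q) = 0 := by
  rw [← Matrix.exists_mulVec_eq_zero_iff]
  constructor
  · rintro ⟨y, hy, h⟩
    refine ⟨polyOfVec y, mt polyOfVec_eq_zero.1 hy, natDegree_polyOfVec_lt hy, fun p hp => ?_⟩
    obtain ⟨x, rfl⟩ := exists_polyOfVec_eq hp
    rw [← dotProduct_hankel_mulVec, h, dotProduct_zero]
  · rintro ⟨q, hq0, hq, h⟩
    obtain ⟨y, rfl⟩ := exists_polyOfVec_eq hq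
    refine ⟨y, mt polyOfVec_eq_zero.2 hq0, dotProduct_eq_zero _ fun x => ?_⟩
    rw [dotProduct_comm, dotProduct_hankel_mulVec]
    by_cases hx : x = 0
    · simp [polyOfVec_eq_zero.2 hx]
    · exact h _ (natDegree_polyOfVec_lt hx)

theorem eval_nodal_id_eq_zero_iff {Z : Finset ℝ} {x : ℝ} :
    (Lagrange.nodal Z id).eval x = 0 ↔ x ∈ Z := by
  simp [Lagrange.eval_nodal, prod_eq_zero_iff, sub_eq_zero]

theorem posDef_hankel_of_eq_sum {m : ℕ → ℝ} {Z : Finset ℝ} {w : ℝ → ℝ} {N : ℕ}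
    (hN : N ≤ Z.card) (hw : ∀ z ∈ Z, 0 < w z)
    (hm : ∀ i < 2 * N - 1, m i = ∑ z ∈ Z, w z * z ^ i) : (hankel m N).PosDef := by
  refine posDef_hankel_iff.2 fun p hp0 hp => ?_
  rw [momentFunctional_eq_sum_eval hm (by rw [natDegree_mul hp0 hp0]; omega)]
  obtain ⟨z, hz, hpz⟩ : ∃ z ∈ Z, p.eval z ≠ 0 := by
    by_contra! h
    exact hp0 (eq_zero_of_natDegree_lt_card_of_eval_eq_zero' p Z h (hp.trans_le hN))
  simp only [eval_mul]
  refine sum_pos' (fun y hy => mul_nonneg (hw y hy).le (mul_self_nonneg _))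
    ⟨z, hz, mul_pos (hw z hz) (mul_self_pos.2 hpz)⟩

theorem det_hankel_eq_zero_of_eq_sum {m : ℕ → ℝ} {Z : Finset ℝ} {w : ℝ → ℝ} {N : ℕ}
    (hN : Z.card < N) (hm : ∀ i < 2 * N - 1, m i = ∑ z ∈ Z, w z * z ^ i) :
    (hankel m N).det = 0 := by
  have hd : (Lagrange.nodal Z id : ℝ[X]).natDegree = Z.card := Lagrange.natDegree_nodal
  refine det_hankel_eq_zero_iff.2 ⟨Lagrange.nodal Z id, Lagrange.nodal_ne_zero, by omega,
    fun p hp => ?_⟩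
  rw [momentFunctional_eq_sum_eval hm
    ((natDegree_mul_le (p := p)).trans_lt (by omega))]
  refine sum_eq_zero fun z hz => ?_
  rw [eval_mul, eval_nodal_id_eq_zero_iff.2 hz, mul_zero, mul_zero]

theorem sum_erase_nodal {Z : Finset ℝ} {z : ℝ} (hz : z ∈ Z) (w : ℝ → ℝ) (f : ℝ[X]) :
    ∑ y ∈ Z, w y * (f * Lagrange.nodal (Z.erase z) id).eval y =
      w z * (f * Lagrange.nodal (Z.erase z) id).eval z := by
  refine sum_eq_single_of_mem z hz fun y hy hyz => ?_
  rw [eval_mul, eval_nodal_id_eq_zero_iff.2 (mem_erase.2 ⟨hyz, hy⟩), mul_zero, mul_zero]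

theorem pos_of_posDef_hankel {m : ℕ → ℝ} {Z : Finset ℝ} {w : ℝ → ℝ} {N : ℕ}
    (hN : Z.card ≤ N) (hpd : (hankel m N).PosDef)
    (hm : ∀ i < 2 * N - 1, m i = ∑ z ∈ Z, w z * z ^ i) {z : ℝ} (hz : z ∈ Z) : 0 < w z := by
  have hd : (Lagrange.nodal (Z.erase z) id : ℝ[X]).natDegree = Z.card - 1 := by
    rw [Lagrange.natDegree_nodal, card_erase_of_mem hz]
  have hc : 0 < Z.card := card_pos.2 ⟨z, hz⟩
  have h := posDef_hankel_iff.1 hpd (Lagrange.nodal (Z.erase z) id) Lagrange.nodal_ne_zero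
    (by omega)
  rw [momentFunctional_eq_sum_eval hm (natDegree_mul_le.trans_lt (by omega)),
    sum_erase_nodal hz, eval_mul] at h
  exact pos_of_mul_pos_left h (mul_self_nonneg _)

/-- A nonzero polynomial of degree at most `r` that is orthogonal to all such polynomials, for a
functional that is positive on squares in degrees below `r`, has no factor `(X - u)² + v²`. -/
theorem not_quadratic_dvd_of_orthogonal {m : ℕ → ℝ} {r : ℕ} {q : ℝ[X]}
    (hpd : (hankel m r).PosDef) (hq0 : q ≠ 0) (hq : q.natDegree ≤ r)
    (horth : ∀ p : ℝ[X], p.natDegree ≤ r → momentFunctional m (p * q) = 0) (u v : ℝ) :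
    ¬ (X - C u) ^ 2 + C (v ^ 2) ∣ q := by
  rintro ⟨h, rfl⟩
  have h0 : h ≠ 0 := right_ne_zero_of_mul hq0
  have hd2 : ((X - C u) ^ 2 + C (v ^ 2)).natDegree = 2 := by
    rw [natDegree_add_C, natDegree_pow, natDegree_X_sub_C]
  rw [natDegree_mul (left_ne_zero_of_mul hq0) h0, hd2] at hq
  rw [posDef_hankel_iff] at hpd
  have h1 := horth h (by omega)
  have h2 := hpd ((X - C u) * h) (mul_ne_zero (X_sub_C_ne_zero u) h0)
    (by rw [natDegree_mul (X_sub_C_ne_zero u) h0, natDegree_X_sub_C]; omega)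
  have h3 := hpd h h0 (by omega)
  have h4 : h * (((X - C u) ^ 2 + C (v ^ 2)) * h) =
      (X - C u) * h * ((X - C u) * h) + v ^ 2 • (h * h) := by
    rw [smul_eq_C_mul]; ring
  rw [h4, map_add, map_smul, smul_eq_mul] at h1
  nlinarith [mul_nonneg (sq_nonneg v) h3.le]

theorem splits_and_nodup_roots {q : ℝ[X]} (hq0 : q ≠ 0)
    (h : ∀ u v : ℝ, ¬ (X - C u) ^ 2 + C (v ^ 2) ∣ q) : q.Splits ∧ q.roots.Nodup := by
  constructor
  · obtain ⟨ε, hε⟩ := UniqueFactorizationMonoid.factors_prod hq0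
    rw [← hε]
    refine (Splits.multisetProd fun g hgq => Splits.of_degree_eq_one ?_).mul ε.isUnit.splits
    have hg := UniqueFactorizationMonoid.irreducible_of_factor g hgq
    replace hgq := UniqueFactorizationMonoid.dvd_of_mem_factors hgq
    obtain ⟨z, hz⟩ := IsAlgClosed.exists_aeval_eq_zero ℂ g (degree_pos_of_irreducible hg).ne'
    by_cases hi : z.im = 0
    · have hr : g.IsRoot z.re := by
        have : (z.re : ℂ) = z := Complex.ext rfl (by simp [hi])
        rw [← this] at hz
        have h2 : aeval ((algebraMap ℝ ℂ) z.re) g = 0 := hz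
        rw [aeval_algebraMap_apply] at h2
        simpa using h2
      exact degree_eq_one_of_irreducible_of_root hg hr
    · refine absurd ((quadratic_dvd_of_aeval_eq_zero_im_ne_zero g hz hi).trans hgq) ?_
      convert h z.re z.im using 2
      rw [Complex.sq_norm, Complex.normSq_apply]
      simp only [C_mul, C_add, C_pow, C_ofNat]
      ring
  · rw [Multiset.nodup_iff_count_le_one]
    intro u
    by_contra! hu
    rw [count_roots] at hu
    refine h u 0 ?_
    simpa using (pow_dvd_pow _ hu).trans (pow_rootMultiplicity_dvd q u)

theorem dvd_of_eval_eq_zero {Z : Finset ℝ} {q f : ℝ[X]} (hq0 : q ≠ 0)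
    (hq : q.natDegree ≤ Z.card) (hqZ : ∀ z ∈ Z, q.eval z = 0) (hf : ∀ z ∈ Z, f.eval z = 0) :
    q ∣ f := by
  rw [← EuclideanDomain.mod_eq_zero]
  refine Polynomial.eq_zero_of_degree_lt_of_eval_finset_eq_zero Z
    ((EuclideanDomain.mod_lt f hq0).trans_le (natDegree_le_iff_degree_le.1 hq)) fun z hz => ?_
  have h := congrArg (eval z) (EuclideanDomain.div_add_mod f q)
  simpa [hqZ z hz, hf z hz] using h

/-- Gauss quadrature for a truncated moment sequence with a singular flat extension. -/
theorem exists_eq_sum_of_posDef_of_det_eq_zero {m : ℕ → ℝ} {r : ℕ} (hpd : (hankel m r).PosDef)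
    (hdet : (hankel m (r + 1)).det = 0) :
    ∃ (Z : Finset ℝ) (w : ℝ → ℝ), Z.card = r ∧
      ∀ i < 2 * r + 1, m i = ∑ z ∈ Z, w z * z ^ i := by
  obtain ⟨q, hq0, hq, horth⟩ := det_hankel_eq_zero_iff.1 hdet
  have hqr : q.natDegree = r := by
    by_contra hne
    exact (posDef_hankel_iff.1 hpd q hq0 (by omega)).ne' (horth q hq)
  obtain ⟨hs, hnd⟩ := splits_and_nodup_roots hq0
    (not_quadratic_dvd_of_orthogonal hpd hq0 hqr.le fun p hp => horth p (by omega))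
  have hcard : q.roots.toFinset.card = r := by
    rw [Multiset.toFinset_card_of_nodup hnd, ← hs.natDegree_eq_card_roots, hqr]
  have hZ : ∀ z ∈ q.roots.toFinset, q.eval z = 0 := fun z hz =>
    (mem_roots hq0).1 (Multiset.mem_toFinset.1 hz)
  generalize q.roots.toFinset = Z at hcard hZ
  refine ⟨Z, fun z => momentFunctional m (Lagrange.basis Z id z), hcard, fun i hi => ?_⟩
  set p := Lagrange.interpolate Z id (fun z => z ^ i) with hp
  have hpd : p.natDegree ≤ r := natDegree_le_iff_degree_le.2 <| by
    rw [← hcard]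
    exact (Lagrange.degree_interpolate_lt _ (Set.injOn_id _)).le
  obtain ⟨h, hh⟩ : q ∣ X ^ i - p := by
    refine dvd_of_eval_eq_zero hq0 (by omega) hZ fun z hz => ?_
    have : p.eval (id z) = z ^ i := Lagrange.eval_interpolate_at_node _ (Set.injOn_id _) hz
    rw [id_eq] at this
    simp [this]
  have hL : momentFunctional m (X ^ i - p) = 0 := by
    rw [hh, mul_comm]
    by_cases h0 : h = 0
    · simp [h0]
    refine horth h ?_
    have h1 := congrArg natDegree hh
    have h2 : (X ^ i - p).natDegree ≤ 2 * r :=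
      (natDegree_sub_le _ _).trans (max_le (by rw [natDegree_X_pow]; omega) (by omega))
    rw [natDegree_mul hq0 h0] at h1
    omega
  rw [map_sub, momentFunctional_X_pow, sub_eq_zero] at hL
  rw [hL, hp, Lagrange.interpolate_apply, map_sum]
  refine sum_congr rfl fun z _ => ?_
  rw [← smul_eq_C_mul, map_smul, smul_eq_mul, mul_comm]

theorem zero_notMem_of_posDef_shift {m : ℕ → ℝ} {Z : Finset ℝ} {w : ℝ → ℝ}
    (hpd : (hankel (fun i => m (i + 2)) Z.card).PosDef)
    (hm : ∀ i < 2 * Z.card + 1, m i = ∑ z ∈ Z, w z * z ^ i) : 0 ∉ Z := by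
  intro h0
  have h := pos_of_posDef_hankel (w := fun z => w z * z ^ 2) le_rfl hpd (fun i hi => ?_) h0
  · simp at h
  · rw [hm _ (by omega)]
    exact sum_congr rfl fun z _ => by ring

theorem eq_sum_of_det_shift_eq_zero {m : ℕ → ℝ} {Z : Finset ℝ} {w : ℝ → ℝ} {N : ℕ}
    (hw : ∀ z ∈ Z, w z ≠ 0) (h0 : 0 ∉ Z)
    (hm : ∀ i < 2 * Z.card + 1, m i = ∑ z ∈ Z, w z * z ^ i)
    (hdet : ∀ d, 2 * Z.card + 1 + d ≤ N → (hankel (fun i => m (i + d)) (Z.card + 1)).det = 0) :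
    ∀ i < N, m i = ∑ z ∈ Z, w z * z ^ i := by
  intro i
  induction i using Nat.strong_induction_on with
  | _ i ih =>
  intro hi
  by_cases hi2 : i < 2 * Z.card + 1
  · exact hm i hi2
  replace ih : ∀ j < i, m j = ∑ z ∈ Z, w z * z ^ j := fun j hj => ih j hj (hj.trans hi)
  obtain ⟨d, rfl⟩ : ∃ d, i = 2 * Z.card + d := ⟨i - 2 * Z.card, by omega⟩
  obtain ⟨q, hq0, hq, horth⟩ := det_hankel_eq_zero_iff.1 (hdet d (by omega))
  simp only [momentFunctional_shift] at horth
  have hqZ : ∀ z ∈ Z, q.eval z = 0 := by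
    intro z hz
    have hd : (Lagrange.nodal (Z.erase z) id : ℝ[X]).natDegree = Z.card - 1 := by
      rw [Lagrange.natDegree_nodal, card_erase_of_mem hz]
    have hc : 0 < Z.card := card_pos.2 ⟨z, hz⟩
    have h := horth (Lagrange.nodal (Z.erase z) id) (by omega)
    have hassoc : X ^ d * (Lagrange.nodal (Z.erase z) id * q) =
      X ^ d * q * Lagrange.nodal (Z.erase z) id := by ring
    have hdeg : (X ^ d * q * Lagrange.nodal (Z.erase z) id).natDegree < 2 * Z.card + d := by
      refine natDegree_mul_le.trans_lt ?_
      have := natDegree_mul_le (p := X ^ d) (q := q)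
      rw [natDegree_X_pow] at this
      omega
    rw [hassoc, momentFunctional_eq_sum_eval ih hdeg, sum_erase_nodal hz] at h
    have hn : (Lagrange.nodal (Z.erase z) id : ℝ[X]).eval z ≠ 0 := by
      simp [eval_nodal_id_eq_zero_iff]
    simpa [hw z hz, hn, ne_of_mem_of_not_mem hz h0] using h
  have hqd : q.natDegree = Z.card := by
    by_contra hne
    exact hq0 (eq_zero_of_natDegree_lt_card_of_eval_eq_zero' q Z hqZ (by omega))
  have h := horth (X ^ Z.card) (by rw [natDegree_X_pow]; omega)
  have hassoc : X ^ d * (X ^ Z.card * q) = q * X ^ (Z.card + d) := by ring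
  have hsum : ∑ z ∈ Z, w z * (q * X ^ (Z.card + d)).eval z = 0 :=
    sum_eq_zero fun z hz => by simp [hqZ z hz]
  have hcoeff : (q * X ^ (Z.card + d)).coeff (2 * Z.card + d) ≠ 0 := by
    rw [two_mul, add_assoc, coeff_mul_X_pow, ← hqd]
    exact leadingCoeff_ne_zero.2 hq0
  have hdeg : (q * X ^ (Z.card + d)).natDegree ≤ 2 * Z.card + d := by
    rw [natDegree_mul_X_pow _ hq0]; omega
  rw [hassoc, momentFunctional_eq_sub_add m Z w, hsum, add_zero,
    momentFunctional_eq_coeff_mul hdeg fun j hj => sub_eq_zero.2 (ih j hj)] at h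
  exact sub_eq_zero.1 ((mul_eq_zero.1 h).resolve_left hcoeff)

theorem eq_of_linear_recurrence {c : ℕ → ℝ} {a b : ℝ} (hab : a < b) {n : ℕ}
    (h : ∀ i, i + 2 < n → c (i + 2) = (a + b) * c (i + 1) - a * b * c i) :
    ∃ α β : ℝ, ∀ i < n, c i = b ^ i * β + a ^ i * α := by
  have hba : b - a ≠ 0 := sub_ne_zero.2 hab.ne'
  refine ⟨(b * c 0 - c 1) / (b - a), (c 1 - a * c 0) / (b - a), fun i => ?_⟩
  induction i using Nat.strong_induction_on with
  | _ i ih =>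
  intro hi
  match i, hi, ih with
  | 0, _, _ => field_simp; ring
  | 1, _, _ => field_simp; ring
  | i + 2, hi, ih =>
    rw [h i hi, ih (i + 1) (by omega) (by omega), ih i (by omega) (by omega)]
    ring

theorem mem_Ioo_of_posDef_localized {c : ℕ → ℝ} {a b : ℝ} (hab : a < b) {Z : Finset ℝ}
    {w : ℝ → ℝ} (hw : ∀ z ∈ Z, 0 < w z)
    (hm : ∀ i < 2 * Z.card + 1,
      -c (i + 2) + (a + b) * c (i + 1) - a * b * c i = ∑ z ∈ Z, w z * z ^ i)
    (hpd : (hankel c (Z.card + 2)).PosDef) : ∀ z ∈ Z, a < z ∧ z < b := by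
  intro z hz
  set g : ℝ[X] := Lagrange.nodal (Z.erase z) id
  have hgd : g.natDegree = Z.card - 1 := by
    rw [Lagrange.natDegree_nodal, card_erase_of_mem hz]
  have hc : 0 < Z.card := card_pos.2 ⟨z, hz⟩
  have hb : C b - X ≠ (0 : ℝ[X]) := by
    rw [← neg_sub, neg_ne_zero]; exact X_sub_C_ne_zero b
  have hbd : (C b - X : ℝ[X]).natDegree = 1 := by
    rw [← neg_sub, natDegree_neg, natDegree_X_sub_C]
  have hl0 : (X - C a) * (C b - X) ≠ 0 := mul_ne_zero (X_sub_C_ne_zero a) hb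
  have hld : ((X - C a) * (C b - X)).natDegree = 2 := by
    rw [natDegree_mul (X_sub_C_ne_zero a) hb, natDegree_X_sub_C, hbd]
  have hg0 : g ≠ 0 := Lagrange.nodal_ne_zero
  have hd : ((X - C a) * (C b - X) * g).natDegree = Z.card + 1 := by
    rw [natDegree_mul hl0 hg0, hld, hgd]; omega
  have h := posDef_hankel_iff.1 hpd ((X - C a) * (C b - X) * g) (mul_ne_zero hl0 hg0) (by omega)
  rw [mul_assoc, mul_left_comm g, ← mul_assoc (_ * _) g g, ← momentFunctional_localized,
    momentFunctional_eq_sum_eval hm, sum_erase_nodal hz] at h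
  · have h1 : 0 < w z * g.eval z ^ 2 * ((z - a) * (b - z)) := by
      simpa [g, mul_assoc, mul_comm, mul_left_comm, pow_two] using h
    have h2 : 0 < (z - a) * (b - z) :=
      pos_of_mul_pos_right h1 (mul_nonneg (hw z hz).le (sq_nonneg _))
    rcases mul_pos_iff.1 h2 with h3 | h3 <;> constructor <;> linarith
  · rw [natDegree_mul (mul_ne_zero hl0 hg0) hg0, hd]; omega

theorem localized_sum {a b : ℝ} {Z : Finset ℝ} {τ : ℝ → ℝ} (i : ℕ) :
    -(∑ z ∈ Z, z ^ (i + 2) * τ z) + (a + b) * (∑ z ∈ Z, z ^ (i + 1) * τ z)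
      - a * b * (∑ z ∈ Z, z ^ i * τ z) = ∑ z ∈ Z, τ z * ((z - a) * (b - z)) * z ^ i := by
  rw [mul_sum, mul_sum, ← sum_neg_distrib, ← sum_add_distrib, ← sum_sub_distrib]
  exact sum_congr rfl fun z _ => by ring

theorem sum_insert_endpoints {a b : ℝ} (hab : a < b) {Z : Finset ℝ}
    (hZ : ∀ z ∈ Z, a < z ∧ z < b) (τ : ℝ → ℝ) (α β : ℝ) (i : ℕ) :
    ∑ z ∈ insert b (insert a Z), (if z = b then β else if z = a then α else τ z) * z ^ i =
      b ^ i * β + (∑ z ∈ Z, z ^ i * τ z) + a ^ i * α := by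
  have ha : a ∉ Z := fun h => (hZ a h).1.false
  have hb : b ∉ insert a Z := by
    rw [mem_insert, not_or]
    exact ⟨hab.ne', fun h => (hZ b h).2.false⟩
  have hs : ∑ z ∈ Z, (if z = b then β else if z = a then α else τ z) * z ^ i =
      ∑ z ∈ Z, z ^ i * τ z := sum_congr rfl fun z hz => by
    rw [if_neg (hZ z hz).2.ne, if_neg (hZ z hz).1.ne', mul_comm]
  rw [sum_insert hb, sum_insert ha, hs]
  simp only [↓reduceIte, hab.ne]
  ring

theorem card_insert_endpoints {a b : ℝ} (hab : a < b) {Z : Finset ℝ}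
    (hZ : ∀ z ∈ Z, a < z ∧ z < b) : (insert b (insert a Z)).card = Z.card + 2 := by
  have ha : a ∉ Z := fun h => (hZ a h).1.false
  have hb : b ∉ insert a Z := by
    rw [mem_insert, not_or]
    exact ⟨hab.ne', fun h => (hZ b h).2.false⟩
  rw [card_insert_of_notMem hb, card_insert_of_notMem ha]

/-- Characterization of truncated moment sequences of discrete measures on `[a, b]` with `r`
nonzero interior atoms and atoms at both endpoints. -/
theorem exists_atoms_iff {n r : ℕ} (hn : 2 * r + 3 ≤ n) {a b : ℝ} (hab : a < b) {c m : ℕ → ℝ}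
    (hmc : ∀ i, m i = -c (i + 2) + (a + b) * c (i + 1) - a * b * c i) :
    (∃ (Z : Finset ℝ) (τ : ℝ → ℝ) (α β : ℝ), Z.card = r ∧ (∀ z ∈ Z, a < z ∧ z < b) ∧ 0 ∉ Z ∧
      (∀ z ∈ Z, 0 < τ z) ∧ 0 < α ∧ 0 < β ∧
      ∀ i < n, c i = b ^ i * β + (∑ z ∈ Z, z ^ i * τ z) + a ^ i * α) ↔
    ((∀ d, 2 * (r + 1) + 1 + d ≤ n → (hankel (fun i => m (i + d)) (r + 1)).det = 0) ∧
      (hankel m r).PosDef ∧ (hankel (fun i => m (i + 2)) r).PosDef ∧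
      (hankel c (r + 2)).PosDef) := by
  constructor
  · rintro ⟨Z, τ, α, β, rfl, hZ, h0, hτ, hα, hβ, hc⟩
    have hm : ∀ i, i + 2 < n → m i = ∑ z ∈ Z, τ z * ((z - a) * (b - z)) * z ^ i := by
      intro i hi
      rw [hmc, hc i (by omega), hc (i + 1) (by omega), hc (i + 2) hi, ← localized_sum]
      ring
    have hw : ∀ z ∈ Z, 0 < τ z * ((z - a) * (b - z)) := fun z hz =>
      mul_pos (hτ z hz) (mul_pos (sub_pos.2 (hZ z hz).1) (sub_pos.2 (hZ z hz).2))
    have hm' (d : ℕ) : ∀ i, i + d + 2 < n →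
        m (i + d) = ∑ z ∈ Z, τ z * ((z - a) * (b - z)) * z ^ d * z ^ i := by
      intro i hi
      rw [hm _ hi]
      exact sum_congr rfl fun z _ => by ring
    refine ⟨fun d hd => det_hankel_eq_zero_of_eq_sum (Nat.lt_succ_self _)
      fun i hi => hm' d i (by omega), posDef_hankel_of_eq_sum le_rfl hw fun i hi => hm i (by omega),
      posDef_hankel_of_eq_sum le_rfl (fun z hz => mul_pos (hw z hz) ?_)
        fun i hi => hm' 2 i (by omega), ?_⟩
    · exact sq_pos_of_ne_zero (ne_of_mem_of_not_mem hz h0)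
    · refine posDef_hankel_of_eq_sum (card_insert_endpoints hab hZ).ge ?_ fun i hi =>
        (hc i (by omega)).trans (sum_insert_endpoints hab hZ τ α β i).symm
      intro z hz
      have := hτ z
      aesop
  · rintro ⟨hdet, hpd, hpd2, hpdc⟩
    obtain ⟨Z, w, rfl, hm⟩ := exists_eq_sum_of_posDef_of_det_eq_zero hpd (hdet 0 (by omega))
    have hw : ∀ z ∈ Z, 0 < w z := fun z hz =>
      pos_of_posDef_hankel le_rfl hpd (fun i hi => hm i (by omega)) hz
    have h0 := zero_notMem_of_posDef_shift hpd2 hm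
    have hZ := mem_Ioo_of_posDef_localized hab hw (fun i hi => (hmc i).symm.trans (hm i hi)) hpdc
    have hmn := eq_sum_of_det_shift_eq_zero (N := n - 2) (fun z hz => (hw z hz).ne') h0 hm
      fun d hd => hdet d (by omega)
    have hl : ∀ z ∈ Z, 0 < (z - a) * (b - z) := fun z hz =>
      mul_pos (sub_pos.2 (hZ z hz).1) (sub_pos.2 (hZ z hz).2)
    set τ : ℝ → ℝ := fun z => w z / ((z - a) * (b - z)) with hτ
    obtain ⟨α, β, he⟩ := eq_of_linear_recurrence (c := fun i => c i - ∑ z ∈ Z, z ^ i * τ z)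
      (n := n) hab fun i hi => by
        have h1 := localized_sum (a := a) (b := b) (Z := Z) (τ := τ) i
        have h2 : ∑ z ∈ Z, τ z * ((z - a) * (b - z)) * z ^ i = m i := by
          rw [hmn i (by omega)]
          exact sum_congr rfl fun z hz => by rw [hτ, div_mul_cancel₀ _ (hl z hz).ne']
        rw [h2, hmc] at h1
        linarith
    have hc : ∀ i < n, c i = b ^ i * β + (∑ z ∈ Z, z ^ i * τ z) + a ^ i * α := fun i hi => by
      linarith [he i hi]
    have hpos {z : ℝ} := pos_of_posDef_hankel (z := z) (card_insert_endpoints hab hZ).le hpdc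
      fun i hi => (hc i (by omega)).trans (sum_insert_endpoints hab hZ τ α β i).symm
    refine ⟨Z, τ, α, β, rfl, hZ, h0, fun z hz => div_pos (hw z hz) (hl z hz), ?_, ?_, hc⟩
    · simpa [hab.ne] using hpos (z := a) (by simp)
    · simpa using hpos (z := b) (by simp)

end MomentFunctional

theorem injOn_of_decreasing {z : ℕ → ℝ} {I : Finset ℕ}
    (h : ∀ s ∈ I, ∀ t ∈ I, s < t → z t < z s) : Set.InjOn z I := by
  intro s hs t ht hst
  rcases lt_trichotomy s t with h' | h' | h'
  · exact absurd hst (h s hs t ht h').ne'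
  · exact h'
  · exact absurd hst (h t ht s hs h').ne

/-- Every finite set of reals can be listed in decreasing order with indices `2, …, r + 1`. -/
theorem exists_decreasing_enumeration (Z : Finset ℝ) : ∃ z : ℕ → ℝ,
    (∀ s ∈ Icc 2 (Z.card + 1), ∀ t ∈ Icc 2 (Z.card + 1), s < t → z t < z s) ∧
    (Icc 2 (Z.card + 1)).image z = Z := by
  set z : ℕ → ℝ := fun s => if h : Z.card + 1 - s < Z.card then
    Z.orderEmbOfFin rfl ⟨Z.card + 1 - s, h⟩ else 0 with hz
  have hzs : ∀ s ∈ Icc 2 (Z.card + 1), ∃ h : Z.card + 1 - s < Z.card,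
      z s = Z.orderEmbOfFin rfl ⟨Z.card + 1 - s, h⟩ := fun s hs => by
    rw [mem_Icc] at hs
    have h : Z.card + 1 - s < Z.card := by omega
    exact ⟨h, dif_pos h⟩
  have hanti : ∀ s ∈ Icc 2 (Z.card + 1), ∀ t ∈ Icc 2 (Z.card + 1), s < t → z t < z s := by
    intro s hs t ht hst
    obtain ⟨h1, e1⟩ := hzs s hs
    obtain ⟨h2, e2⟩ := hzs t ht
    rw [e1, e2, OrderEmbedding.lt_iff_lt, Fin.mk_lt_mk]
    rw [mem_Icc] at hs ht
    omega
  refine ⟨z, hanti, eq_of_subset_of_card_le ?_ ?_⟩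
  · intro x hx
    obtain ⟨s, hs, rfl⟩ := mem_image.1 hx
    obtain ⟨h, e⟩ := hzs s hs
    rw [e]
    exact orderEmbOfFin_mem _ _ _
  · rw [card_image_of_injOn (injOn_of_decreasing hanti), Nat.card_Icc]
    omega

/-- Part (B) of the solvability lemma for the truncated Hausdorff moment problem:
existence of a representing step function with exactly `k+1` nonzero points of growth,
including both endpoints `a` and `b`, for moments `c₁, …, c_n`. -/
theorem stmt_2 (n k : ℕ) (hn : 4 ≤ n) (hk : 1 ≤ k) (hkn : 2 * k + 1 ≤ n)
    (a b : ℝ) (hab : a < b) (c : ℕ → ℝ) :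
    (∃ z σ : ℕ → ℝ,
      (∀ s ∈ Icc 2 k, ∀ t ∈ Icc 2 k, s < t → z t < z s) ∧
      (∀ s ∈ Icc 2 k, a < z s ∧ z s < b) ∧
      (∀ s ∈ Icc 2 k, z s ≠ 0) ∧
      (∀ s ∈ Icc 1 (k + 1), 0 < σ s) ∧
      (∀ j ∈ Icc 1 n, c j =
        b ^ (j - 1) * σ 1 + (∑ s ∈ Icc 2 k, z s ^ (j - 1) * σ s) + a ^ (j - 1) * σ (k + 1)))
    ↔
    ((∀ d : ℕ, 2 * k + 1 + d ≤ n →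
        (Matrix.of fun i j : Fin k =>
          -c (i.1 + j.1 + 3 + d) + (a + b) * c (i.1 + j.1 + 2 + d)
            - a * b * c (i.1 + j.1 + 1 + d)).det = 0) ∧
      (Matrix.of fun i j : Fin (k - 1) =>
        -c (i.1 + j.1 + 3) + (a + b) * c (i.1 + j.1 + 2) - a * b * c (i.1 + j.1 + 1)).PosDef ∧
      (Matrix.of fun i j : Fin (k - 1) =>
        -c (i.1 + j.1 + 5) + (a + b) * c (i.1 + j.1 + 4) - a * b * c (i.1 + j.1 + 3)).PosDef ∧
      (Matrix.of fun i j : Fin (k + 1) => c (i.1 + j.1 + 1)).PosDef) := by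
  obtain ⟨r, rfl⟩ : ∃ r, k = r + 1 := ⟨k - 1, by omega⟩
  have key := exists_atoms_iff (n := n) (r := r) (by omega) hab (c := fun i => c (i + 1))
    (m := fun i => -c (i + 3) + (a + b) * c (i + 2) - a * b * c (i + 1)) fun i => rfl
  have h1 (d : ℕ) : (Matrix.of fun i j : Fin (r + 1) =>
      -c (i.1 + j.1 + 3 + d) + (a + b) * c (i.1 + j.1 + 2 + d)
        - a * b * c (i.1 + j.1 + 1 + d)) =
      hankel (fun i => -c (i + d + 3) + (a + b) * c (i + d + 2) - a * b * c (i + d + 1))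
        (r + 1) := by
    ext i j
    simp only [hankel, Matrix.of_apply, Nat.add_right_comm _ d]
  simp only [h1]
  refine Iff.trans ?_ key
  constructor
  · rintro ⟨z, σ, hanti, hz, hz0, hσ, hc⟩
    have hinj := injOn_of_decreasing hanti
    have hinv : ∀ s ∈ Icc 2 (r + 1), Function.invFunOn z (Icc 2 (r + 1)) (z s) = s :=
      fun s hs => hinj.leftInvOn_invFunOn hs
    refine ⟨(Icc 2 (r + 1)).image z, fun x => σ (Function.invFunOn z (Icc 2 (r + 1)) x),
      σ (r + 1 + 1), σ 1, ?_, ?_, ?_, ?_, hσ _ (by simp), hσ _ (by simp), fun i hi => ?_⟩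
    · rw [card_image_of_injOn hinj, Nat.card_Icc]
      omega
    · simpa only [forall_mem_image] using hz
    · simpa only [mem_image, not_exists, not_and] using hz0
    · rw [forall_mem_image]
      intro s hs
      simp only [hinv s hs]
      rw [mem_Icc] at hs
      exact hσ s (mem_Icc.2 (by omega))
    · rw [hc (i + 1) (mem_Icc.2 (by omega)), Nat.add_sub_cancel, sum_image hinj]
      congr 2
      exact sum_congr rfl fun s hs => by simp only [hinv s hs]
  · rintro ⟨Z, τ, α, β, rfl, hZ, h0, hτ, hα, hβ, hc⟩
    obtain ⟨z, hanti, hzZ⟩ := exists_decreasing_enumeration Z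
    have hmem : ∀ s ∈ Icc 2 (Z.card + 1), z s ∈ Z := fun s hs =>
      hzZ.subset (mem_image_of_mem z hs)
    refine ⟨z, fun s => if s = 1 then β else if s = Z.card + 2 then α else τ (z s), hanti,
      fun s hs => hZ _ (hmem s hs), fun s hs => ne_of_mem_of_not_mem (hmem s hs) h0,
      fun s hs => ?_, fun j hj => ?_⟩
    · dsimp only
      split_ifs
      · exact hβ
      · exact hα
      · rw [mem_Icc] at hs
        exact hτ _ (hmem s (mem_Icc.2 (by omega)))
    · rw [mem_Icc] at hj
      obtain ⟨i, rfl⟩ : ∃ i, j = i + 1 := ⟨j - 1, by omega⟩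
      have hs : ∑ x ∈ Z, x ^ i * τ x = ∑ s ∈ Icc 2 (Z.card + 1), z s ^ i *
          (if s = 1 then β else if s = Z.card + 2 then α else τ (z s)) := by
        conv_lhs => rw [← hzZ, sum_image (injOn_of_decreasing hanti)]
        refine sum_congr rfl fun s hs => ?_
        rw [mem_Icc] at hs
        rw [if_neg (by omega), if_neg (by omega)]
      rw [hc i (by omega), hs]
      simp
end

section
/- Let k ≥ 2 be an integer, let b be a real number, let z₂, …, z_k be pairwise distinct real numbers with z_s < b for all s, let σ₂, …, σ_k > 0, let σ₁ ≥ 0, and set c_j = b^{j−1}σ₁ + Σ_{s=2}^{k} z_s^{j−1} σ_s for j = 1, …, 2k−1. Let P(z) denote the determinant of the k×k matrix whose i-th row, for i = 1,…,k−1, is (c^{b}_i, c^{b}_{i+1}, …, c^{b}_{i+k−1}) and whose k-th row is (1, z, z², …, z^{k−1}). Then P is a polynomial of degree exactly k−1 in z whose set of real roots is exactly {z₂, …, z_k}. -/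
theorem Matrix.det_vandermonde_cons {R : Type*} [CommRing R] {n : ℕ} (x : R) (y : Fin n → R) :
    (Matrix.vandermonde (Fin.cons x y : Fin (n + 1) → R)).det =
      (∏ s, (y s - x)) * (Matrix.vandermonde y).det := by
  rw [Matrix.det_vandermonde, Fin.prod_univ_succ]
  simp [Matrix.det_vandermonde, Fin.prod_Ioi_succ]

/-- The determinant whose first `n` rows are the Hankel rows of the moments of the discrete
measure with masses `w s` at `y s`, and whose last row lists the powers of `x`, factors as a
constant times `∏ s, (x - y s)`. -/
theorem det_momentHankel_powers {R : Type*} [CommRing R] {n : ℕ} (w y : Fin n → R) (x : R) :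
    (Matrix.of fun i j : Fin (n + 1) =>
      if i.1 + 1 < n + 1 then ∑ s, w s * y s ^ (i.1 + j.1) else x ^ j.1).det =
      (∏ s, w s) * (Matrix.vandermonde y).det ^ 2 * ∏ s, (x - y s) := by
  let A : Matrix (Fin (n + 1)) (Fin (n + 1)) R := Matrix.of fun i =>
    if i.1 < n then Fin.cons 0 fun s => w s * y s ^ i.1 else Fin.cons 1 0
  have hmul : (Matrix.of fun i j : Fin (n + 1) =>
      if i.1 + 1 < n + 1 then ∑ s, w s * y s ^ (i.1 + j.1) else x ^ j.1) =
      A * Matrix.vandermonde (Fin.cons x y : Fin (n + 1) → R) := by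
    ext i j
    by_cases hi : i.1 < n <;>
      simp [A, hi, Matrix.mul_apply, Fin.sum_univ_succ, Matrix.vandermonde_apply, pow_add,
        mul_assoc, -Matrix.vandermonde_cons]
  have hA : A.det = (-1) ^ n * ((∏ s, w s) * (Matrix.vandermonde y).det) := by
    rw [Matrix.det_succ_row A (Fin.last n), Fin.sum_univ_succ]
    have hsub : A.submatrix (Fin.last n).succAbove (0 : Fin (n + 1)).succAbove =
        (Matrix.of fun s i => w s * Matrix.vandermonde y s i).transpose := by
      ext i s
      simp [A, Matrix.vandermonde_apply]
    rw [hsub, Matrix.det_transpose, Matrix.det_mul_column]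
    simp [A]
  have hneg : ∏ s, (x - y s) = (-1) ^ n * ∏ s, (y s - x) := by
    rw [← Fin.prod_const n (-1 : R), ← Finset.prod_mul_distrib]
    exact Finset.prod_congr rfl fun s _ => by ring
  rw [hmul, Matrix.det_mul, hA, Matrix.det_vandermonde_cons, hneg]
  ring

open Finset

/-- The determinantal polynomial built from the transformed moments
`c^{b}_j = -c_{j+1} + b·c_j` of a discrete measure with mass `σ₁ ≥ 0` at `b` and masses
`σ_s > 0` at pairwise distinct points `z_s < b`, `s = 2,…,k`, has degree exactly `k-1`
and its real roots are exactly `z₂,…,z_k`. -/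
theorem stmt_5 (k : ℕ) (hk : 2 ≤ k) (b : ℝ) (z σ : ℕ → ℝ)
    (hz : ∀ s ∈ Icc 2 k, ∀ t ∈ Icc 2 k, s ≠ t → z s ≠ z t)
    (hzb : ∀ s ∈ Icc 2 k, z s < b)
    (hσ : ∀ s ∈ Icc 2 k, 0 < σ s)
    (hσ1 : 0 ≤ σ 1)
    (c : ℕ → ℝ)
    (hc : ∀ j ∈ Icc 1 (2 * k - 1), c j =
      b ^ (j - 1) * σ 1 + ∑ s ∈ Icc 2 k, z s ^ (j - 1) * σ s) :
    ∃ p : Polynomial ℝ,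
      (∀ x : ℝ, p.eval x =
        (Matrix.of fun i j : Fin k =>
          if i.1 + 1 < k then -c (i.1 + j.1 + 2) + b * c (i.1 + j.1 + 1)
          else x ^ j.1).det) ∧
      p.degree = (k - 1 : ℕ) ∧
      (∀ x : ℝ, p.eval x = 0 ↔ ∃ s ∈ Icc 2 k, z s = x) := by
  obtain ⟨n, rfl⟩ : ∃ n, k = n + 1 := ⟨k - 1, by omega⟩
  let y : Fin n → ℝ := fun s => z (s + 2)
  let w : Fin n → ℝ := fun s => (b - z (s + 2)) * σ (s + 2)
  have hmem (s : Fin n) : s.1 + 2 ∈ Icc 2 (n + 1) := by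
    rw [mem_Icc]; omega
  have hw (s : Fin n) : w s ≠ 0 :=
    (mul_pos (sub_pos.2 (hzb _ (hmem s))) (hσ _ (hmem s))).ne'
  have hy : Function.Injective y := fun s t hst => by
    by_contra hne
    exact hz _ (hmem s) _ (hmem t) (by simpa [Fin.ext_iff] using hne) hst
  have hsum (f : ℕ → ℝ) : ∑ s ∈ Icc 2 (n + 1), f s = ∑ s : Fin n, f (s + 2) := by
    rw [Fin.sum_univ_eq_sum_range (fun s => f (s + 2)), ← Finset.Ico_succ_right_eq_Icc,
      Finset.sum_Ico_eq_sum_range]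
    simp [add_comm, show 1 + (n + 1) - 2 = n by omega]
  set K : ℝ := (∏ s, w s) * (Matrix.vandermonde y).det ^ 2 with hK
  have hK0 : K ≠ 0 :=
    mul_ne_zero (prod_ne_zero_iff.2 fun s _ => hw s)
      (pow_ne_zero _ (Matrix.det_vandermonde_ne_zero_iff.2 hy))
  refine ⟨Polynomial.C K * ∏ s, (Polynomial.X - Polynomial.C (y s)), fun x => ?_, ?_,
    fun x => ?_⟩
  · rw [Polynomial.eval_mul, Polynomial.eval_C, Polynomial.eval_prod]
    simp only [Polynomial.eval_sub, Polynomial.eval_X, Polynomial.eval_C]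
    rw [hK, ← det_momentHankel_powers]
    congr 2
    ext i j
    split_ifs with hi
    · rw [hc _ (by rw [mem_Icc]; omega), hc _ (by rw [mem_Icc]; omega), hsum, hsum]
      simp only [Nat.add_sub_cancel, show i.1 + j.1 + 2 - 1 = i.1 + j.1 + 1 by omega, mul_add,
        neg_add, mul_sum, ← sum_neg_distrib]
      rw [add_add_add_comm, ← sum_add_distrib,
        show -(b ^ (i.1 + j.1 + 1) * σ 1) + b * (b ^ (i.1 + j.1) * σ 1) = 0 by ring, zero_add]
      exact sum_congr rfl fun s _ => by simp only [w, y]; ring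
    · rfl
  · rw [Polynomial.degree_C_mul hK0, Polynomial.degree_prod]
    simp
  · rw [Polynomial.eval_mul, Polynomial.eval_C, Polynomial.eval_prod, mul_eq_zero,
      or_iff_right hK0, prod_eq_zero_iff]
    simp only [mem_univ, true_and, Polynomial.eval_sub, Polynomial.eval_X, Polynomial.eval_C,
      sub_eq_zero]
    constructor
    · rintro ⟨s, hs⟩
      exact ⟨s + 2, hmem s, hs.symm⟩
    · rintro ⟨s, hs, rfl⟩
      rw [mem_Icc] at hs
      exact ⟨⟨s - 2, by omega⟩, by simp [y, Nat.sub_add_cancel hs.1]⟩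
end
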